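/- Let κ be a positive and connected standard kernel, let K_κ(x,dy) = κ(x,y) dy / ∫_0^1 κ(x,v) dv, and let π be the probability measure with density dπ/dx = (∫_0^1 κ(x,v) dv)/(∫_0^1 ∫_0^1 κ(u,v) du dv). Let X = (X_1, X_2, …) be a Markov chain on [0,1] with transition kernel K_κ. Then for every bounded measurable f: [0,1] → ℝ and for almost every x ∈ [0,1], (1/n) Σ_{i=1}^n f(X_i) → ∫_0^1 f dπ P[·|X_1 = x]-almost surely as n → ∞. -/

import Mathlib

open MeasureTheory Filter
open scoped ENNReal Classical

noncomputable section

/-- The Markov transition `K_κ(x,A) = (∫_{A∩[0,1]} κ(x,y) dy) / (∫_0^1 κ(x,v) dv)`. -/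
def markovStep (κ : ℝ → ℝ → ℝ) (x : ℝ) (A : Set ℝ) : ℝ :=
  (∫ y in A ∩ Set.Icc (0:ℝ) 1, κ x y) / ∫ v in Set.Icc (0:ℝ) 1, κ x v

set_option linter.unusedSectionVars false

def maxSum {Ω : Type*} (T : Ω → Ω) (g : Ω → ℝ) : ℕ → Ω → ℝ
  | 0 => g
  | (n+1) => fun ω => g ω + max 0 (maxSum T g n (T ω))

section erg
variable {Ω : Type*} [MeasurableSpace Ω] {μ : Measure Ω} [IsProbabilityMeasure μ] {T : Ω → Ω}

lemma maxSum_succ {Ω : Type*} {T : Ω → Ω} (g : Ω → ℝ) (n : ℕ) (ω : Ω) :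
    maxSum T g (n+1) ω = g ω + max 0 (maxSum T g n (T ω)) := rfl

lemma maxSum_mono (g : Ω → ℝ) (n : ℕ) (ω : Ω) : maxSum T g n ω ≤ maxSum T g (n+1) ω := by
  induction n generalizing ω with
  | zero => simp [maxSum]
  | succ n ih =>
    have := ih (T ω)
    rw [maxSum_succ, maxSum_succ]
    gcongr

lemma le_maxSum (g : Ω → ℝ) (n : ℕ) (ω : Ω) : birkhoffSum T g (n+1) ω ≤ maxSum T g n ω := by
  induction n generalizing ω with
  | zero => simp [maxSum, birkhoffSum]
  | succ n ih =>
    rw [birkhoffSum_succ', maxSum_succ]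
    have := ih (T ω)
    gcongr
    exact this.trans (le_max_right _ _)

lemma maxSum_meas (hT : Measurable T) {g : Ω → ℝ} (hg : Measurable g) (n : ℕ) :
    Measurable (maxSum T g n) := by
  induction n with
  | zero => exact hg
  | succ n ih =>
    exact hg.add (measurable_const.max (ih.comp hT))

lemma maxSum_bdd {g : Ω → ℝ} {C : ℝ} (hg : ∀ ω, |g ω| ≤ C) (n : ℕ) (ω : Ω) :
    |maxSum T g n ω| ≤ (n + 1) * C := by
  induction n generalizing ω with
  | zero => simpa [maxSum] using hg ω
  | succ n ih =>
    have h1 := ih (T ω)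
    have h2 := hg ω
    have h0 : 0 ≤ (n+1) * C := (abs_nonneg _).trans h1
    rw [maxSum_succ]
    have h3 : |max 0 (maxSum T g n (T ω))| ≤ (n+1) * C := by
      rw [abs_of_nonneg (le_max_left _ _)]
      exact max_le h0 ((le_abs_self _).trans h1)
    have := abs_add_le (g ω) (max 0 (maxSum T g n (T ω)))
    push_cast
    linarith

lemma bdd_above_of_neg (hT : Ergodic T μ) {g : Ω → ℝ} (hg : Measurable g) {C : ℝ}
    (hC : ∀ ω, |g ω| ≤ C) (hneg : ∫ ω, g ω ∂μ < 0) :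
    ∀ᵐ ω ∂μ, ∃ c : ℝ, ∀ n, birkhoffSum T g (n+1) ω ≤ c := by
  have hTm := hT.measurable
  set E : Set Ω := {ω | ∀ c : ℕ, ∃ n, (c:ℝ) < maxSum T g n ω} with hE
  have hEm : MeasurableSet E := by
    have : E = ⋂ c : ℕ, ⋃ n, {ω | (c:ℝ) < maxSum T g n ω} := by
      ext ω; simp [hE]
    rw [this]
    exact MeasurableSet.iInter fun c => MeasurableSet.iUnion fun n =>
      measurableSet_lt measurable_const (maxSum_meas hTm hg n)
  have hinv : T ⁻¹' E = E := by
    ext ω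
    simp only [hE, Set.mem_preimage, Set.mem_ofPred_eq]
    have hgω := abs_le.1 (hC ω)
    constructor
    · intro h c
      obtain ⟨N, hN⟩ := exists_nat_gt ((c:ℝ) + C)
      obtain ⟨n, hn⟩ := h N
      refine ⟨n+1, ?_⟩
      rw [maxSum_succ]
      have := le_max_right 0 (maxSum T g n (T ω))
      linarith
    · intro h c
      obtain ⟨N, hN⟩ := exists_nat_gt ((c:ℝ) + C)
      obtain ⟨n, hn⟩ := h N
      have hn2 := hn.trans_le (maxSum_mono g n ω)
      refine ⟨n, ?_⟩
      rw [maxSum_succ] at hn2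
      have hc : (0:ℝ) ≤ c := Nat.cast_nonneg c
      rcases le_total 0 (maxSum T g n (T ω)) with h0 | h0
      · rw [max_eq_right h0] at hn2; linarith
      · rw [max_eq_left h0] at hn2; linarith
  have hcase := hT.toPreErgodic.ae_empty_or_univ hEm hinv
  rcases hcase with h | h
  · have h' : ∀ᵐ ω ∂μ, ω ∉ E := by
      rw [ae_eq_empty] at h
      exact measure_eq_zero_iff_ae_notMem.1 h
    filter_upwards [h'] with ω hω
    simp only [hE, Set.mem_ofPred_eq] at hω
    push Not at hω
    obtain ⟨c, hc⟩ := hω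
    exact ⟨c, fun n => (le_maxSum g n ω).trans (hc n)⟩
  · exfalso
    have h' : ∀ᵐ ω ∂μ, ω ∈ E := by
      rw [eventuallyEq_univ] at h; exact h
    have hint : ∀ n, Integrable (maxSum T g n) μ := fun n =>
      Integrable.of_bound (maxSum_meas hTm hg n).aestronglyMeasurable ((n+1)*C)
        (ae_of_all _ fun ω => by simpa using maxSum_bdd hC n ω)
    have hmp := hT.toMeasurePreserving
    have hint2 : ∀ n, Integrable (fun ω => maxSum T g n (T ω)) μ := fun n =>
      hmp.integrable_comp_of_integrable (hint n)
    have heq : ∀ n, ∫ ω, maxSum T g n (T ω) ∂μ = ∫ ω, maxSum T g n ω ∂μ := fun n => by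
      conv_rhs => rw [← hmp.map_eq]
      rw [integral_map hTm.aemeasurable]
      exact (maxSum_meas hTm hg n).aestronglyMeasurable
    have hpos : ∀ n, 0 ≤ ∫ ω, (maxSum T g (n+1) ω - maxSum T g n (T ω)) ∂μ := fun n => by
      rw [integral_sub (hint _) (hint2 _), heq, sub_nonneg]
      exact integral_mono (hint _) (hint _) (maxSum_mono g n)
    have hlim : Tendsto (fun n => ∫ ω, (maxSum T g (n+1) ω - maxSum T g n (T ω)) ∂μ) atTop
        (nhds (∫ ω, g ω ∂μ)) := by
      refine tendsto_integral_of_dominated_convergence (fun _ => 2 * C) ?_ (integrable_const _) ?_ ?_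
      · intro n
        exact ((maxSum_meas hTm hg _).sub ((maxSum_meas hTm hg n).comp hTm)).aestronglyMeasurable
      · intro n
        refine ae_of_all _ fun ω => ?_
        have h1 := abs_le.1 (hC ω)
        have h2 := abs_le.1 (hC (T ω))
        have h3 : g (T ω) ≤ maxSum T g n (T ω) :=
          monotone_nat_of_le_succ (f := fun n => maxSum T g n (T ω))
            (fun n => maxSum_mono g n (T ω)) (Nat.zero_le n)
        rw [maxSum_succ, Real.norm_eq_abs, abs_le]
        rcases le_total 0 (maxSum T g n (T ω)) with h0 | h0
        · rw [max_eq_right h0]; constructor <;> linarith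
        · rw [max_eq_left h0]; constructor <;> linarith
      · filter_upwards [h'] with ω hω
        have hω2 : T ω ∈ E := by rw [← hinv] at hω; exact hω
        obtain ⟨N, hN⟩ := hω2 0
        refine tendsto_const_nhds.congr' ?_
        filter_upwards [eventually_ge_atTop N] with n hn
        have h3 : maxSum T g N (T ω) ≤ maxSum T g n (T ω) :=
          monotone_nat_of_le_succ (f := fun n => maxSum T g n (T ω))
            (fun n => maxSum_mono g n (T ω)) hn
        have : 0 ≤ maxSum T g n (T ω) := by
          have : (0:ℝ) < maxSum T g N (T ω) := by simpa using hN
          linarith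
        rw [maxSum_succ, max_eq_right this]; ring
    exact absurd (ge_of_tendsto' hlim hpos) (not_le.2 hneg)

lemma birkhoff_upper (hT : Ergodic T μ) {g : Ω → ℝ} (hg : Measurable g) {C : ℝ}
    (hC : ∀ ω, |g ω| ≤ C) {ε : ℝ} (hε : 0 < ε) :
    ∀ᵐ ω ∂μ, ∀ᶠ n : ℕ in atTop, (n:ℝ)⁻¹ * birkhoffSum T g n ω < ∫ ω, g ω ∂μ + ε := by
  set m := ∫ ω, g ω ∂μ with hm
  have hgi : Integrable g μ := Integrable.of_bound hg.aestronglyMeasurable C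
        (ae_of_all _ fun ω => by simpa using hC ω)
  have := bdd_above_of_neg hT (g := fun ω => g ω - (m + ε/2)) (hg.sub measurable_const)
    (C := C + |m + ε/2|) (fun ω => (abs_sub _ _).trans (by linarith [hC ω])) (by
      rw [integral_sub hgi (integrable_const _)]; simp [← hm]; linarith)
  filter_upwards [this] with ω ⟨c, hc⟩
  obtain ⟨N, hN⟩ := exists_nat_gt (c / (ε/2))
  filter_upwards [eventually_ge_atTop (N+1)] with n hn
  have hn0 : (0:ℝ) < n := by exact_mod_cast (by omega : 0 < n)
  have h1 := hc (n-1)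
  rw [Nat.sub_add_cancel (by omega)] at h1
  simp only [birkhoffSum, Finset.sum_sub_distrib, Finset.sum_const, Finset.card_range,
    nsmul_eq_mul] at h1 ⊢
  rw [div_lt_iff₀ (by positivity)] at hN
  have hn' : (N:ℝ) ≤ n := by exact_mod_cast (by omega : N ≤ n)
  rw [inv_mul_lt_iff₀ hn0]
  nlinarith

theorem birkhoff_ergodic (hT : Ergodic T μ) {g : Ω → ℝ} (hg : Measurable g) {C : ℝ}
    (hC : ∀ ω, |g ω| ≤ C) :
    ∀ᵐ ω ∂μ, Tendsto (fun n : ℕ => (n:ℝ)⁻¹ * birkhoffSum T g n ω) atTop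
      (nhds (∫ ω, g ω ∂μ)) := by
  have h1 : ∀ᵐ ω ∂μ, ∀ k : ℕ, ∀ᶠ n : ℕ in atTop,
      (n:ℝ)⁻¹ * birkhoffSum T g n ω < ∫ ω, g ω ∂μ + 1 / ((k:ℝ)+1) :=
    ae_all_iff.2 fun k => birkhoff_upper hT hg hC (by positivity)
  have h2 : ∀ᵐ ω ∂μ, ∀ k : ℕ, ∀ᶠ n : ℕ in atTop,
      (n:ℝ)⁻¹ * birkhoffSum T (fun ω => - g ω) n ω < ∫ ω, - g ω ∂μ + 1 / ((k:ℝ)+1) :=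
    ae_all_iff.2 fun k => birkhoff_upper hT hg.neg (C := C) (by simpa using hC) (by positivity)
  filter_upwards [h1, h2] with ω a b
  rw [Metric.tendsto_atTop']
  intro ε hε
  obtain ⟨k, hk⟩ := exists_nat_one_div_lt hε
  obtain ⟨N, hN⟩ := eventually_atTop.1 ((a k).and (b k))
  refine ⟨N, fun n hn => ?_⟩
  obtain ⟨h3, h4⟩ := hN n hn.le
  rw [integral_neg] at h4
  simp only [birkhoffSum, Finset.sum_neg_distrib, mul_neg] at h3 h4 ⊢
  rw [Real.dist_eq, abs_lt]
  constructor <;> linarith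
end erg

open ProbabilityTheory

def shiftMap (S : Type*) (ω : ℕ → S) : ℕ → S := fun n => ω (n+1)

lemma shiftMap_meas (S : Type*) [MeasurableSpace S] : Measurable (shiftMap S) :=
  measurable_pi_iff.2 fun n => measurable_pi_apply (n+1)

def rect {S : Type*} (n : ℕ) (A : ℕ → Set S) : Set (ℕ → S) := {ω | ∀ i < n, ω i ∈ A i}

section mk
variable {S : Type*} [MeasurableSpace S]

lemma rect_meas (n : ℕ) {A : ℕ → Set S} (hA : ∀ i, MeasurableSet (A i)) :
    MeasurableSet (rect n A) := by
  have : rect n A = ⋂ i, ⋂ (_ : i < n), (fun ω : ℕ → S => ω i) ⁻¹' (A i) := by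
    ext ω; simp [rect]
  rw [this]
  exact MeasurableSet.iInter fun i => MeasurableSet.iInter fun _ => measurable_pi_apply i (hA i)

lemma sqcyl_rect {R : Set (ℕ → S)}
    (hR : R ∈ squareCylinders (fun _ : ℕ => {s : Set S | MeasurableSet s})) :
    ∃ n A, (∀ i, MeasurableSet (A i)) ∧ R = rect n A := by
  obtain ⟨s, t, ht, rfl⟩ := hR
  refine ⟨s.sup id + 1, fun i => if i ∈ s then t i else Set.univ, ?_, ?_⟩
  · intro i
    dsimp only
    split_ifs
    · exact ht i (Set.mem_univ i)
    · exact MeasurableSet.univ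
  · ext ω
    simp only [Set.mem_pi, rect, Set.mem_ofPred_eq, Finset.mem_coe]
    constructor
    · intro h i _
      split_ifs with hi
      · exact h i hi
      · trivial
    · intro h i hi
      have := h i (Nat.lt_succ_of_le (Finset.le_sup (f := id) hi))
      simpa [hi] using this

lemma ext_rect {μ ν : Measure (ℕ → S)} [IsFiniteMeasure μ]
    (h : ∀ n A, (∀ i, MeasurableSet (A i)) → μ (rect n A) = ν (rect n A)) : μ = ν := by
  refine ext_of_generate_finite _ generateFrom_squareCylinders.symm
    (isPiSystem_squareCylinders (fun _ => MeasurableSpace.isPiSystem_measurableSet)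
      (fun _ => MeasurableSet.univ)) ?_ ?_
  · intro s hs
    obtain ⟨n, A, hA, rfl⟩ := sqcyl_rect hs
    exact h n A hA
  · simpa [rect] using h 0 (fun _ => Set.univ) (fun _ => MeasurableSet.univ)

variable (K : Kernel S S) [IsMarkovKernel K]

def iterV : ℕ → (ℕ → S → ℝ≥0∞) → S → ℝ≥0∞
  | 0, _, _ => 1
  | (n+1), G, x => G 0 x * ∫⁻ y, iterV n (fun i => G (i+1)) y ∂(K x)

lemma iterV_meas (n : ℕ) {G : ℕ → S → ℝ≥0∞} (hG : ∀ i, Measurable (G i)) :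
    Measurable (iterV K n G) := by
  induction n generalizing G with
  | zero => exact measurable_const
  | succ n ih => exact (hG 0).mul (ih (fun i => hG (i+1))).lintegral_kernel

lemma iterV_last (n : ℕ) (G : ℕ → S → ℝ≥0∞) (x : S) :
    iterV K (n+2) G x = iterV K (n+1)
      (fun i => if i = n then fun y => G n y * ∫⁻ z, G (n+1) z ∂(K y) else G i) x := by
  induction n generalizing G x with
  | zero => simp [iterV]
  | succ n ih =>
    rw [iterV]
    conv_rhs => rw [iterV]
    simp_rw [ih]
    simp

variable {K} {I : Set S} {P : S → Measure (ℕ → S)} (hP : ∀ x, IsProbabilityMeasure (P x))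
  (hstart : ∀ x ∈ I, ∀ᵐ ω ∂(P x), ω 0 = x)
  (hM : ∀ x ∈ I, ∀ (n : ℕ) (B : Set (Fin (n + 1) → S)),
      MeasurableSet B → ∀ A : Set S, MeasurableSet A →
      P x {ω | (fun i : Fin (n + 1) => ω i.1) ∈ B ∧ ω (n + 1) ∈ A}
        = ∫⁻ ω in {ω : ℕ → S | (fun i : Fin (n + 1) => ω i.1) ∈ B}, K (ω n) A ∂(P x))

include hP hM in
lemma last_step {x : S} (hx : x ∈ I) (n : ℕ) {Φ : (Fin (n+1) → S) → ℝ≥0∞} (hΦ : Measurable Φ)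
    {g : S → ℝ≥0∞} (hg : Measurable g) :
    ∫⁻ ω, Φ (fun i => ω i.1) * g (ω (n+1)) ∂(P x)
      = ∫⁻ ω, Φ (fun i => ω i.1) * ∫⁻ z, g z ∂(K (ω n)) ∂(P x) := by
  have hr : Measurable (fun (ω : ℕ → S) (i : Fin (n+1)) => ω i.1) :=
    measurable_pi_iff.2 fun i => measurable_pi_apply _
  have hl : Measurable (fun v : Fin (n+1) → S => v (Fin.last n)) := measurable_pi_apply _
  have hrl : Measurable (fun (ω : ℕ → S) => ((fun i : Fin (n+1) => ω i.1), ω (n+1))) :=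
    hr.prodMk (measurable_pi_apply _)
  have key : (P x).map (fun (ω : ℕ → S) => ((fun i : Fin (n+1) => ω i.1), ω (n+1)))
      = ((P x).map (fun (ω : ℕ → S) (i : Fin (n+1)) => ω i.1)) ⊗ₘ (K.comap _ hl) := by
    have := Measure.isProbabilityMeasure_map (μ := P x) hr.aemeasurable
    have := Measure.isProbabilityMeasure_map (μ := P x) hrl.aemeasurable
    refine Measure.ext_prod ?_
    intro s t hs ht
    rw [Measure.compProd_apply_prod hs ht, Measure.map_apply hrl (hs.prod ht),
      setLIntegral_map hs (Kernel.measurable_coe _ ht) hr]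
    exact hM x hx n s hs t ht
  have h1 : Measurable (fun p : (Fin (n+1) → S) × S => Φ p.1 * g p.2) := by fun_prop
  have h2 := lintegral_map (μ := P x) h1 hrl
  have := Measure.isProbabilityMeasure_map (μ := P x) hr.aemeasurable
  rw [← h2, key, Measure.lintegral_compProd h1, lintegral_map _ hr]
  · congr with ω
    simp only [Kernel.comap_apply]
    rw [lintegral_const_mul _ hg]
    simp
  · exact Measurable.lintegral_kernel_prod_right' (κ := K.comap _ hl) h1

include hP hM hstart in
lemma prod_eq_iterV {x : S} (hx : x ∈ I) (n : ℕ) {G : ℕ → S → ℝ≥0∞} (hG : ∀ i, Measurable (G i)) :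
    ∫⁻ ω, ∏ i ∈ Finset.range n, G i (ω i) ∂(P x) = iterV K n G x := by
  induction n generalizing G with
  | zero => simp [iterV]
  | succ n ih =>
    cases n with
    | zero =>
      simp only [zero_add, Finset.range_one, Finset.prod_singleton, iterV, lintegral_const,
        measure_univ, mul_one]
      have : (fun ω : ℕ → S => G 0 (ω 0)) =ᵐ[P x] fun _ => G 0 x := by
        filter_upwards [hstart x hx] with ω h
        rw [h]
      rw [lintegral_congr_ae this]; simp
    | succ n =>
      rw [iterV_last, ← ih]
      · have h := last_step hP hM hx n (Φ := fun v => ∏ i : Fin (n+1), G i.1 (v i))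
          (by fun_prop) (hG (n+1))
        have e1 : ∀ ω : ℕ → S, ∏ i : Fin (n+1), G i.1 (ω i.1) = ∏ i ∈ Finset.range (n+1), G i (ω i) :=
          fun ω => Fin.prod_univ_eq_prod_range (fun i => G i (ω i)) (n+1)
        simp only [e1] at h
        simp_rw [Finset.prod_range_succ _ (n+1)]
        rw [h]
        congr with ω
        rw [Finset.prod_range_succ, Finset.prod_range_succ]
        simp only [if_true]
        rw [mul_assoc]
        congr 1
        refine Finset.prod_congr rfl fun i hi => ?_
        rw [if_neg (Finset.mem_range.1 hi).ne]
      · intro i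
        split_ifs with hi
        · exact (hG n).mul (hG _).lintegral_kernel
        · exact hG i

def indG (A : ℕ → Set S) (i : ℕ) : S → ℝ≥0∞ := (A i).indicator 1

lemma indG_meas {A : ℕ → Set S} (hA : ∀ i, MeasurableSet (A i)) (i : ℕ) : Measurable (indG A i) :=
  measurable_one.indicator (hA i)

include hP hM hstart in
lemma rect_eq_iterV {x : S} (hx : x ∈ I) (n : ℕ) {A : ℕ → Set S} (hA : ∀ i, MeasurableSet (A i)) :
    P x (rect n A) = iterV K n (indG A) x := by
  rw [← prod_eq_iterV hP hstart hM hx n (indG_meas hA), ← lintegral_indicator_one (rect_meas n hA)]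
  congr with ω
  by_cases h : ω ∈ rect n A
  · rw [Set.indicator_of_mem h]
    rw [Finset.prod_eq_one]; · rfl
    intro i hi
    simp [indG, h i (Finset.mem_range.1 hi)]
  · rw [Set.indicator_of_notMem h]
    simp only [rect, Set.mem_ofPred_eq, not_forall] at h
    obtain ⟨i, hi, hh⟩ := h
    rw [Finset.prod_eq_zero (Finset.mem_range.2 hi)]
    simp [indG, hh]

include hP hM hstart in
lemma exists_pathKernel (hI : MeasurableSet I) (hKI : ∀ x ∈ I, ∀ᵐ y ∂(K x), y ∈ I)
    (x₀ : S) : ∃ Pk : Kernel S (ℕ → S), IsMarkovKernel Pk ∧ (∀ x ∈ I, Pk x = P x) ∧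
      ∀ x ∈ I, ∀ A₀ E, MeasurableSet A₀ → MeasurableSet E →
        Pk x ((fun ω => ω 0) ⁻¹' A₀ ∩ shiftMap S ⁻¹' E)
          = A₀.indicator 1 x * ∫⁻ y, Pk y E ∂(K x) := by
  let P' : S → Measure (ℕ → S) := fun x => if x ∈ I then P x else P x₀
  have hP'I : ∀ x ∈ I, P' x = P x := fun x hx => by simp [P', hx]
  have hP' : ∀ x, IsProbabilityMeasure (P' x) := fun x => by
    dsimp only [P']; split_ifs <;> exact hP _
  have hmeas : Measurable P' := by
    refine Measurable.measure_of_isPiSystem_of_isProbabilityMeasure generateFrom_squareCylinders.symm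
      (isPiSystem_squareCylinders (fun _ => MeasurableSpace.isPiSystem_measurableSet)
      (fun _ => MeasurableSet.univ)) ?_
    intro s hs
    obtain ⟨n, A, hA, rfl⟩ := sqcyl_rect hs
    have : (fun a => P' a (rect n A)) = fun a => if a ∈ I then iterV K n (indG A) a
        else P x₀ (rect n A) := by
      ext a
      dsimp only [P']
      split_ifs with ha
      · exact rect_eq_iterV hP hstart hM ha n hA
      · rfl
    rw [this]
    exact Measurable.ite hI (iterV_meas K n (indG_meas hA)) measurable_const
  let Pk : Kernel S (ℕ → S) := ⟨P', hmeas⟩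
  have hPk : IsMarkovKernel Pk := ⟨hP'⟩
  refine ⟨Pk, hPk, hP'I, ?_⟩
  intro x hx A₀ E hA₀ hE
  have key : (P x).map (shiftMap S) = Pk ∘ₘ (K x) := by
    have := Measure.isProbabilityMeasure_map (μ := P x) (shiftMap_meas S).aemeasurable
    refine ext_rect fun n A hA => ?_
    rw [Measure.map_apply (shiftMap_meas S) (rect_meas n hA),
      Measure.bind_apply (rect_meas n hA) Pk.aemeasurable]
    let A' : ℕ → Set S := fun i => Nat.casesOn i Set.univ A
    have hA' : ∀ i, MeasurableSet (A' i) := fun i => by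
      cases i with
      | zero => exact MeasurableSet.univ
      | succ i => exact hA i
    have : shiftMap S ⁻¹' (rect n A) = rect (n+1) A' := by
      ext ω
      simp only [Set.mem_preimage, rect, shiftMap, Set.mem_ofPred_eq]
      constructor
      · intro h i hi
        cases i with
        | zero => trivial
        | succ i => exact h i (by omega)
      · intro h i hi
        exact h (i+1) (by omega)
    rw [this, rect_eq_iterV hP hstart hM hx _ hA', iterV]
    have e : indG A' 0 x = 1 := by simp [indG, A']
    rw [e, one_mul]
    refine lintegral_congr_ae ?_
    filter_upwards [hKI x hx] with y hy
    have : Pk y = P y := hP'I y hy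
    rw [this, rect_eq_iterV hP hstart hM hy _ hA]
    rfl
  have e2 : P x (shiftMap S ⁻¹' E) = ∫⁻ y, Pk y E ∂(K x) := by
    rw [← Measure.map_apply (shiftMap_meas S) hE, key, Measure.bind_apply hE Pk.aemeasurable]
  have e3 : Pk x = P x := hP'I x hx
  rw [e3]
  by_cases h : x ∈ A₀
  · rw [Set.indicator_of_mem h, Pi.one_apply, one_mul, ← e2]
    refine measure_congr ?_
    filter_upwards [hstart x hx] with ω hω
    apply propext
    change (ω 0 ∈ A₀ ∧ _) ↔ _
    rw [hω]
    exact ⟨fun a => a.2, fun a => ⟨h, a⟩⟩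
  · rw [Set.indicator_of_notMem h, zero_mul]
    refine measure_mono_null Set.inter_subset_left ?_
    rw [measure_eq_zero_iff_ae_notMem]
    filter_upwards [hstart x hx] with ω hω
    simpa [hω] using h

theorem ergodic_shift {π : Measure S} [IsProbabilityMeasure π] {Pk : Kernel S (ℕ → S)}
    [IsMarkovKernel Pk]
    (hstep : ∀ᵐ x ∂π, ∀ A₀ E, MeasurableSet A₀ → MeasurableSet E →
        Pk x ((fun ω => ω 0) ⁻¹' A₀ ∩ shiftMap S ⁻¹' E)
          = A₀.indicator 1 x * ∫⁻ y, Pk y E ∂(K x))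
    (hinv : K ∘ₘ π = π)
    (hharm : ∀ h : S → ℝ≥0∞, Measurable h → (∀ x, h x ≤ 1) →
      (∀ᵐ x ∂π, h x = ∫⁻ y, h y ∂(K x)) → ∃ c, ∀ᵐ x ∂π, h x = c) :
    Ergodic (shiftMap S) (Pk ∘ₘ π) := by
  have hm : ∀ E, MeasurableSet E → Measurable (fun x => Pk x E) := fun E hE =>
    Kernel.measurable_coe _ hE
  have hstep' : ∀ᵐ x ∂π, ∀ E, MeasurableSet E →
        Pk x (shiftMap S ⁻¹' E) = ∫⁻ y, Pk y E ∂(K x) := by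
    filter_upwards [hstep] with x hx E hE
    simpa using hx Set.univ E MeasurableSet.univ hE
  refine { measurable := shiftMap_meas S, map_eq := ?_, aeconst_set := ?_ }
  · ext E hE
    rw [Measure.map_apply (shiftMap_meas S) hE,
      Measure.bind_apply (shiftMap_meas S hE) Pk.aemeasurable,
      Measure.bind_apply hE Pk.aemeasurable]
    conv_rhs => rw [← hinv]
    rw [Measure.lintegral_bind K.aemeasurable (hm E hE).aemeasurable]
    refine lintegral_congr_ae ?_
    filter_upwards [hstep'] with x hx using hx E hE
  · intro E hE hEinv
    obtain ⟨c, hc⟩ := hharm (fun x => Pk x E) (hm E hE) (fun x => prob_le_one) (by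
      filter_upwards [hstep'] with x hx
      rw [← hx E hE, hEinv])
    have hrect : ∀ n (A : ℕ → Set S), (∀ i, MeasurableSet (A i)) →
        ∀ᵐ x ∂π, Pk x (rect n A ∩ E) = c * Pk x (rect n A) := by
      intro n
      induction n with
      | zero =>
        intro A hA
        filter_upwards [hc] with x hx
        simpa [rect] using hx
      | succ n ih =>
        intro A hA
        have e : rect (n+1) A = (fun ω => ω 0) ⁻¹' (A 0) ∩ shiftMap S ⁻¹' (rect n fun i => A (i+1)) := by
          ext ω
          simp only [rect, shiftMap, Set.mem_ofPred_eq, Set.mem_inter_iff, Set.mem_preimage]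
          constructor
          · intro h
            exact ⟨h 0 (by omega), fun i hi => h (i+1) (by omega)⟩
          · rintro ⟨h0, h⟩ i hi
            cases i with
            | zero => exact h0
            | succ i => exact h i (by omega)
        have e2 : rect (n+1) A ∩ E = (fun ω => ω 0) ⁻¹' (A 0) ∩
            shiftMap S ⁻¹' ((rect n fun i => A (i+1)) ∩ E) := by
          rw [Set.preimage_inter, hEinv, e, Set.inter_assoc]
        have hr := rect_meas n (fun i => hA (i+1))
        have ih2 := ih (fun i => A (i+1)) (fun i => hA (i+1))
        rw [← hinv] at ih2
        have ih3 := Measure.ae_ae_of_ae_comp ih2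
        filter_upwards [hstep, ih3] with x hx hx3
        rw [e2, e, hx _ _ (hA 0) (hr.inter hE), hx _ _ (hA 0) hr, lintegral_congr_ae hx3,
          lintegral_const_mul _ (hm _ hr)]
        ring
    have hres : (Pk ∘ₘ π).restrict E = c • (Pk ∘ₘ π) := by
      refine ext_rect fun n A hA => ?_
      have hr := rect_meas n hA
      rw [Measure.restrict_apply hr, Measure.smul_apply, smul_eq_mul,
        Measure.bind_apply (hr.inter hE) Pk.aemeasurable, Measure.bind_apply hr Pk.aemeasurable,
        ← lintegral_const_mul _ (hm _ hr)]
      exact lintegral_congr_ae (hrect n A hA)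
    have hc1 : (Pk ∘ₘ π) E = c := by
      have := congrArg (fun m => m Set.univ) hres
      simpa using this
    have hc2 : (Pk ∘ₘ π) E = c * c := by
      have := congrArg (fun m => m E) hres
      simpa [hc1] using this
    rw [eventuallyConst_set']
    have hcle : c ≤ 1 := hc1 ▸ prob_le_one
    have hctop : c ≠ ∞ := ne_top_of_le_ne_top ENNReal.one_ne_top hcle
    by_cases h0 : c = 0
    · left
      rw [ae_eq_empty, hc1, h0]
    · right
      have : c = 1 := by
        have h : c * 1 = c * c := by rw [mul_one, ← hc2, hc1]
        exact ((ENNReal.mul_right_inj h0 hctop).1 h).symm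
      rw [eventuallyEq_univ]
      exact (prob_compl_eq_zero_iff hE).2 (by rw [hc1, this])
end mk

section conc
variable {S : Type*} [MeasurableSpace S] (lam : Measure S) [IsProbabilityMeasure lam]
  (k : S → S → ℝ)

def dE (x : S) : ℝ≥0∞ := ∫⁻ y, ENNReal.ofReal (k x y) ∂lam

def stepK : Kernel S S :=
  Kernel.withDensity (Kernel.const S lam) (fun x y => ENNReal.ofReal (k x y) / dE lam k x)

def piM : Measure S := lam.withDensity (fun x => dE lam k x / ∫⁻ u, dE lam k u ∂lam)

variable {lam k} (hk : Measurable (Function.uncurry k)) (hs : ∀ x y, k x y = k y x)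
  (hr : ∀ x y, k x y ∈ Set.Icc (0:ℝ) 1) (hpos : ∀ x, 0 < ∫ y, k x y ∂lam)

include hk in
lemma dE_meas : Measurable (dE lam k) :=
  Measurable.lintegral_prod_right' (f := fun p : S × S => ENNReal.ofReal (k p.1 p.2))
    hk.ennreal_ofReal

include hk hr in
lemma k_int (x : S) : Integrable (k x) lam :=
  Integrable.of_bound (hk.comp measurable_prodMk_left).aestronglyMeasurable 1
    (ae_of_all _ fun y => by
      have := hr x y
      simpa [abs_of_nonneg this.1] using this.2)

include hk hr in
lemma dE_eq (x : S) : dE lam k x = ENNReal.ofReal (∫ y, k x y ∂lam) :=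
  (ofReal_integral_eq_lintegral_ofReal (k_int hk hr x) (ae_of_all _ fun y => (hr x y).1)).symm

include hk hr hpos in
lemma dE_ne_zero (x : S) : dE lam k x ≠ 0 := by
  rw [dE_eq hk hr]; simpa using hpos x

include hr in
lemma dE_le_one (x : S) : dE lam k x ≤ 1 := by
  calc dE lam k x ≤ ∫⁻ y, 1 ∂lam := lintegral_mono fun y => by
        simpa using (hr x y).2
    _ = 1 := by simp

include hr in
lemma dE_ne_top (x : S) : dE lam k x ≠ ∞ := ne_top_of_le_ne_top ENNReal.one_ne_top (dE_le_one hr x)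

include hk in
lemma dens_meas : Measurable (Function.uncurry fun x y => ENNReal.ofReal (k x y) / dE lam k x) :=
  hk.ennreal_ofReal.div ((dE_meas hk).comp measurable_fst)

include hk in
lemma stepK_lintegral (x : S) {g : S → ℝ≥0∞} (hg : Measurable g) :
    ∫⁻ y, g y ∂(stepK lam k x) = (∫⁻ y, ENNReal.ofReal (k x y) * g y ∂lam) / dE lam k x := by
  have h1 : Measurable (fun y => ENNReal.ofReal (k x y)) :=
    (hk.comp measurable_prodMk_left).ennreal_ofReal
  rw [stepK, Kernel.withDensity_apply _ (dens_meas hk), Kernel.const_apply,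
    lintegral_withDensity_eq_lintegral_mul _ (h1.div_const _) hg,
    ENNReal.div_eq_inv_mul, ← lintegral_const_mul _ (by exact h1.mul hg)]
  congr with y
  simp only [Pi.mul_apply, ENNReal.div_eq_inv_mul]
  ring

include hk hr hpos in
lemma stepK_markov : IsMarkovKernel (stepK lam k) := by
  refine ⟨fun x => ⟨?_⟩⟩
  rw [← lintegral_one, stepK_lintegral hk x measurable_const]
  simp only [mul_one]
  exact ENNReal.div_self (dE_ne_zero hk hr hpos x) (dE_ne_top hr x)

include hk hr hpos in
lemma D_ne_zero : ∫⁻ u, dE lam k u ∂lam ≠ 0 := by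
  rw [Ne, lintegral_eq_zero_iff (dE_meas hk)]
  intro h
  obtain ⟨x, hx⟩ := h.exists
  exact dE_ne_zero hk hr hpos x hx

include hr in
lemma D_ne_top : ∫⁻ u, dE lam k u ∂lam ≠ ∞ := by
  refine ne_top_of_le_ne_top ENNReal.one_ne_top ?_
  calc _ ≤ ∫⁻ y, 1 ∂lam := lintegral_mono fun y => dE_le_one hr y
    _ = 1 := by simp

include hk hr hpos in
lemma piM_prob : IsProbabilityMeasure (piM lam k) := by
  refine ⟨?_⟩
  rw [piM, withDensity_apply _ MeasurableSet.univ, Measure.restrict_univ]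
  simp only [div_eq_mul_inv]
  rw [lintegral_mul_const _ (dE_meas hk)]
  exact ENNReal.mul_inv_cancel (D_ne_zero hk hr hpos) (D_ne_top hr)

include hk hr hpos in
lemma lam_ac : lam ≪ piM lam k := by
  refine withDensity_absolutelyContinuous' ((dE_meas hk).div_const _).aemeasurable ?_
  exact ae_of_all _ fun x => (ENNReal.div_pos (dE_ne_zero hk hr hpos x) (D_ne_top hr)).ne'

include hk hs hr hpos in
lemma piM_inv : stepK lam k ∘ₘ piM lam k = piM lam k := by
  ext A hA
  rw [Measure.bind_apply hA (Kernel.aemeasurable _)]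
  have h1 : ∀ x, stepK lam k x A
      = (∫⁻ y, ENNReal.ofReal (k x y) * A.indicator 1 y ∂lam) / dE lam k x := fun x => by
    rw [← stepK_lintegral hk x (measurable_one.indicator hA), lintegral_indicator_one hA]
  have hm : Measurable (fun p : S × S => ENNReal.ofReal (k p.1 p.2) * A.indicator 1 p.2) :=
    hk.ennreal_ofReal.mul ((measurable_one.indicator hA).comp measurable_snd)
  have hm1 : Measurable (fun x => ∫⁻ y, ENNReal.ofReal (k x y) * A.indicator 1 y ∂lam) :=
    Measurable.lintegral_prod_right' hm
  rw [piM, lintegral_withDensity_eq_lintegral_mul _ ((dE_meas hk).div_const _)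
    (Kernel.measurable_coe _ hA), withDensity_apply _ hA]
  have h2 : ∀ x, ((fun x => dE lam k x / ∫⁻ u, dE lam k u ∂lam) * fun x => stepK lam k x A) x
      = (∫⁻ y, ENNReal.ofReal (k x y) * A.indicator 1 y ∂lam) * (∫⁻ u, dE lam k u ∂lam)⁻¹ := by
    intro x
    rw [Pi.mul_apply, h1, div_eq_mul_inv, div_eq_mul_inv]
    have := ENNReal.mul_inv_cancel (dE_ne_zero hk hr hpos x) (dE_ne_top hr x)
    generalize (dE lam k x)⁻¹ = a at *
    calc _ = (dE lam k x * a) * ((∫⁻ y, ENNReal.ofReal (k x y) * A.indicator 1 y ∂lam) *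
        (∫⁻ u, dE lam k u ∂lam)⁻¹) := by ring
      _ = _ := by rw [this, one_mul]
  rw [lintegral_congr h2, lintegral_mul_const _ hm1, lintegral_lintegral_swap hm.aemeasurable]
  simp only [div_eq_mul_inv]
  rw [lintegral_mul_const _ (dE_meas hk), ← lintegral_indicator hA]
  congr 2 with y
  by_cases hy : y ∈ A
  · simp [hy, dE, hs y]
  · simp [hy]

include hk hs hr hpos in
lemma harm_const
    (hconn : ∀ A, MeasurableSet A → lam A ≠ 0 → lam Aᶜ ≠ 0 →
      0 < ∫ x in A, ∫ y in Aᶜ, k x y ∂lam ∂lam)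
    (h : S → ℝ≥0∞) (hm : Measurable h) (h1 : ∀ x, h x ≤ 1)
    (hh : ∀ᵐ x ∂(piM lam k), h x = ∫⁻ y, h y ∂(stepK lam k x)) :
    ∃ c, ∀ᵐ x ∂(piM lam k), h x = c := by
  have hac : piM lam k ≪ lam := withDensity_absolutelyContinuous _ _
  replace hh := (lam_ac hk hr hpos).ae_le hh
  have htop : ∀ x, h x ≠ ∞ := fun x => ne_top_of_le_ne_top ENNReal.one_ne_top (h1 x)
  set g : S → ℝ := fun x => (h x).toReal with hg
  have hgm : Measurable g := hm.ennreal_toReal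
  have hg0 : ∀ x, 0 ≤ g x := fun x => ENNReal.toReal_nonneg
  have hg1 : ∀ x, g x ≤ 1 := fun x => by
    simpa using ENNReal.toReal_mono ENNReal.one_ne_top (h1 x)
  have hbi : ∀ F : S × S → ℝ, Measurable F → (∀ p, |F p| ≤ 1) → Integrable F (lam.prod lam) :=
    fun F hF hb => Integrable.of_bound hF.aestronglyMeasurable 1 (ae_of_all _ hb)
  have hharm : ∀ᵐ x ∂lam, (∫ y, k x y ∂lam) * g x = ∫ y, k x y * g y ∂lam := by
    filter_upwards [hh] with x hx
    rw [stepK_lintegral hk x hm, ENNReal.eq_div_iff (dE_ne_zero hk hr hpos x) (dE_ne_top hr x)] at hx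
    have := congrArg ENNReal.toReal hx
    rw [ENNReal.toReal_mul, dE_eq hk hr, ENNReal.toReal_ofReal (hpos x).le] at this
    rw [this, integral_eq_lintegral_of_nonneg_ae (ae_of_all _ fun y => mul_nonneg (hr x y).1 (hg0 y))]
    · congr 1
      refine lintegral_congr fun y => ?_
      rw [ENNReal.ofReal_mul (hr x y).1, ENNReal.ofReal_toReal (htop y)]
    · exact ((hk.comp measurable_prodMk_left).mul hgm).aestronglyMeasurable
  have hb : ∀ a b c : ℝ, 0 ≤ a → a ≤ 1 → 0 ≤ b → b ≤ 1 → 0 ≤ c → c ≤ 1 → |a * (b * c)| ≤ 1 := by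
    intro a b c ha ha' hb hb' hc hc'
    rw [abs_of_nonneg (by positivity)]
    exact mul_le_one₀ ha' (by positivity) (mul_le_one₀ hb' hc hc')
  have hk' : Measurable (fun p : S × S => k p.1 p.2) := hk
  have i1 : Integrable (fun p : S × S => k p.1 p.2 * (g p.1 * g p.1)) (lam.prod lam) :=
    hbi _ (by fun_prop) fun p => hb _ _ _ (hr _ _).1 (hr _ _).2 (hg0 _) (hg1 _) (hg0 _) (hg1 _)
  have i2 : Integrable (fun p : S × S => k p.1 p.2 * (g p.2 * g p.2)) (lam.prod lam) :=
    hbi _ (by fun_prop) fun p => hb _ _ _ (hr _ _).1 (hr _ _).2 (hg0 _) (hg1 _) (hg0 _) (hg1 _)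
  have i3 : Integrable (fun p : S × S => k p.1 p.2 * (g p.1 * g p.2)) (lam.prod lam) :=
    hbi _ (by fun_prop) fun p => hb _ _ _ (hr _ _).1 (hr _ _).2 (hg0 _) (hg1 _) (hg0 _) (hg1 _)
  have e1 : ∫ p, k p.1 p.2 * (g p.1 * g p.1) ∂(lam.prod lam)
      = ∫ x, (∫ y, k x y ∂lam) * (g x * g x) ∂lam := by
    rw [integral_prod _ i1]
    simp only [integral_mul_const]
  have e2 : ∫ p, k p.1 p.2 * (g p.2 * g p.2) ∂(lam.prod lam)
      = ∫ x, (∫ y, k x y ∂lam) * (g x * g x) ∂lam := by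
    rw [integral_prod_symm _ i2]
    simp only [integral_mul_const]
    congr with x
    simp only [hs x]
  have e3 : ∫ p, k p.1 p.2 * (g p.1 * g p.2) ∂(lam.prod lam)
      = ∫ x, (∫ y, k x y ∂lam) * (g x * g x) ∂lam := by
    rw [integral_prod _ i3]
    refine integral_congr_ae ?_
    filter_upwards [hharm] with x hx
    rw [← mul_assoc, hx, ← integral_mul_const]
    congr with y
    ring
  have ez : ∫ p, k p.1 p.2 * (g p.1 - g p.2)^2 ∂(lam.prod lam) = 0 := by
    have : ∀ p : S × S, k p.1 p.2 * (g p.1 - g p.2)^2 = k p.1 p.2 * (g p.1 * g p.1)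
      + k p.1 p.2 * (g p.2 * g p.2) - 2 * (k p.1 p.2 * (g p.1 * g p.2)) := fun p => by ring
    simp_rw [this]
    rw [integral_sub (by exact i1.add i2) (i3.const_mul 2), integral_add i1 i2, integral_const_mul,
      e1, e2, e3]
    ring
  have iz : Integrable (fun p : S × S => k p.1 p.2 * (g p.1 - g p.2)^2) (lam.prod lam) := by
    refine hbi _ (by fun_prop) fun p => ?_
    have a1 := hr p.1 p.2
    have := hg0 p.1; have := hg0 p.2; have := hg1 p.1; have := hg1 p.2
    rw [abs_of_nonneg (mul_nonneg a1.1 (sq_nonneg _))]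
    refine mul_le_one₀ a1.2 (sq_nonneg _) ?_
    rw [sq_le_one_iff_abs_le_one, abs_le]; constructor <;> linarith
  rw [integral_eq_zero_iff_of_nonneg (fun p => mul_nonneg (hr _ _).1 (sq_nonneg _)) iz] at ez
  have ez2 := Measure.ae_ae_of_ae_prod ez
  have : ∃ c, h =ᵐ[lam] Function.const S c := by
    refine Filter.exists_eventuallyEq_const_of_forall_separating MeasurableSet ?_
    intro U hU
    by_contra hcon
    push Not at hcon
    obtain ⟨c1, c2⟩ := hcon
    have hA : MeasurableSet (h ⁻¹' U) := hm hU
    have hp := hconn (h ⁻¹' U) hA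
      (fun h0 => c2 (measure_eq_zero_iff_ae_notMem.1 h0))
      (fun h0 => c1 (by
        filter_upwards [measure_eq_zero_iff_ae_notMem.1 h0] with x hx
        simpa using hx))
    refine hp.ne' ?_
    refine setIntegral_eq_zero_of_ae_eq_zero ?_
    filter_upwards [ez2] with x hx hxA
    refine setIntegral_eq_zero_of_ae_eq_zero ?_
    filter_upwards [hx] with y hy hyA
    simp only [Pi.zero_apply, mul_eq_zero, ne_eq, OfNat.ofNat_ne_zero, not_false_eq_true,
      pow_eq_zero_iff, sub_eq_zero] at hy
    rcases hy with hy | hy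
    · exact hy
    · exfalso
      have : h x = h y := (ENNReal.toReal_eq_toReal_iff' (htop x) (htop y)).1 hy
      apply hyA
      change h y ∈ U
      rw [← this]; exact hxA
  obtain ⟨c, hc⟩ := this
  exact ⟨c, hac.ae_le hc⟩

include hk hr in
lemma piM_integral (f : S → ℝ) :
    ∫ x, f x ∂(piM lam k) = ∫ x, f x * ((∫ v, k x v ∂lam) / ∫ u, ∫ v, k u v ∂lam ∂lam) ∂lam := by
  have hi : ∀ x, ∫ v, k x v ∂lam = (dE lam k x).toReal := fun x => by
    rw [dE_eq hk hr, ENNReal.toReal_ofReal (integral_nonneg fun y => (hr x y).1)]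
  have hD : ∫ u, ∫ v, k u v ∂lam ∂lam = (∫⁻ u, dE lam k u ∂lam).toReal := by
    simp_rw [hi]
    exact integral_toReal (dE_meas hk).aemeasurable
      (ae_of_all _ fun x => (dE_ne_top hr x).lt_top)
  rw [piM]
  by_cases hD0 : ∫⁻ u, dE lam k u ∂lam = 0
  · have : dE lam k =ᵐ[lam] 0 := (lintegral_eq_zero_iff (dE_meas hk)).1 hD0
    rw [hD, hD0]
    have e : (fun x => dE lam k x / 0) =ᵐ[lam] 0 := by
      filter_upwards [this] with x hx
      simp [hx]
    rw [withDensity_congr_ae e]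
    simp
  rw [integral_withDensity_eq_integral_toReal_smul ((dE_meas hk).div_const _)
    (ae_of_all _ fun x => ENNReal.div_lt_top (dE_ne_top hr x) hD0)]
  congr with x
  rw [hD, hi, ENNReal.toReal_div, smul_eq_mul, mul_comm]
end conc

/-- ergodic theorem for the one-referral Markov chain. Here `P x` is the
law on path space `ℕ → ℝ` of the Markov chain with transition kernel
`K_κ(x,dy) = κ(x,y) dy / ∫_0^1 κ(x,v) dv` started at `x`, and `π` is the invariant
measure with density `(∫_0^1 κ(x,v) dv)/(∫_0^1 ∫_0^1 κ(u,v) du dv)`.  For every bounded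
measurable `f` and almost every starting point `x ∈ [0,1]`, the time averages
`(1/n) ∑_{i=1}^n f(X_i)` converge `P x`-almost surely to `∫_0^1 f dπ`. -/
theorem markov_chain_ergodic_theorem
    (κ : ℝ → ℝ → ℝ) (hκmeas : Measurable (Function.uncurry κ))
    (hκsymm : ∀ a ∈ Set.Icc (0:ℝ) 1, ∀ b ∈ Set.Icc (0:ℝ) 1, κ a b = κ b a)
    (hκrange : ∀ a ∈ Set.Icc (0:ℝ) 1, ∀ b ∈ Set.Icc (0:ℝ) 1, κ a b ∈ Set.Icc (0:ℝ) 1)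
    (hκpos : ∀ x ∈ Set.Icc (0:ℝ) 1, 0 < ∫ y in Set.Icc (0:ℝ) 1, κ x y)
    (hκconn : ∀ A : Set ℝ, A ⊆ Set.Icc 0 1 → MeasurableSet A →
      0 < volume A → volume A < 1 →
      0 < ∫ x in A, ∫ y in Set.Icc (0:ℝ) 1 \ A, κ x y)
    -- the canonical laws of the Markov chain with kernel `K_κ`, started at `x`
    (P : ℝ → Measure (ℕ → ℝ)) (hP : ∀ x, IsProbabilityMeasure (P x))
    (hstart : ∀ x ∈ Set.Icc (0:ℝ) 1, P x {ω | ω 0 = x} = 1)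
    (hMarkov : ∀ x ∈ Set.Icc (0:ℝ) 1, ∀ (n : ℕ) (B : Set (Fin (n + 1) → ℝ)),
      MeasurableSet B → ∀ A : Set ℝ, MeasurableSet A →
      P x {ω | (fun i : Fin (n + 1) => ω i.1) ∈ B ∧ ω (n + 1) ∈ A}
        = ∫⁻ ω in {ω : ℕ → ℝ | (fun i : Fin (n + 1) => ω i.1) ∈ B},
            ENNReal.ofReal (markovStep κ (ω n) A) ∂(P x)) :
    ∀ f : ℝ → ℝ, Measurable f → (∃ C, ∀ y, |f y| ≤ C) →
      ∀ᵐ x ∂(volume.restrict (Set.Icc (0:ℝ) 1)),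
        ∀ᵐ ω ∂(P x), Tendsto
          (fun n : ℕ => (n : ℝ)⁻¹ * ∑ i ∈ Finset.range n, f (ω i)) atTop
          (nhds (∫ y in Set.Icc (0:ℝ) 1,
            f y * ((∫ v in Set.Icc (0:ℝ) 1, κ y v) /
              ∫ u in Set.Icc (0:ℝ) 1, ∫ v in Set.Icc (0:ℝ) 1, κ u v))) := by
  intro f hf hfC
  obtain ⟨C, hC⟩ := hfC
  set I : Set ℝ := Set.Icc (0:ℝ) 1 with hIdef
  have hI : MeasurableSet I := measurableSet_Icc
  set lam : Measure ℝ := volume.restrict I with hlam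
  have hlamP : IsProbabilityMeasure lam := ⟨by simp [hlam, hIdef]⟩
  let k : ℝ → ℝ → ℝ := fun x y => if x ∈ I ∧ y ∈ I then κ x y else 1
  have hkI : ∀ x ∈ I, ∀ y ∈ I, k x y = κ x y := fun x hx y hy => by simp [k, hx, hy]
  have hk : Measurable (Function.uncurry k) :=
    Measurable.ite (hI.prod hI) hκmeas measurable_const
  have hs : ∀ x y, k x y = k y x := by
    intro x y
    by_cases hx : x ∈ I <;> by_cases hy : y ∈ I
    · rw [hkI x hx y hy, hkI y hy x hx, hκsymm x hx y hy]
    all_goals simp [k, hx, hy]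
  have hr : ∀ x y, k x y ∈ Set.Icc (0:ℝ) 1 := by
    intro x y
    by_cases h : x ∈ I ∧ y ∈ I
    · rw [hkI x h.1 y h.2]; exact hκrange x h.1 y h.2
    · simp [k, h]
  have hset : ∀ x ∈ I, ∀ A : Set ℝ, MeasurableSet A →
      ∫ y in A, k x y ∂lam = ∫ y in A ∩ I, κ x y := by
    intro x hx A hA
    rw [hlam, Measure.restrict_restrict hA]
    exact setIntegral_congr_fun (hA.inter hI) fun y hy => hkI x hx y hy.2
  have hrow : ∀ x ∈ I, ∫ y, k x y ∂lam = ∫ y in I, κ x y := by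
    intro x hx
    exact setIntegral_congr_fun hI fun y hy => hkI x hx y hy
  have hpos : ∀ x, 0 < ∫ y, k x y ∂lam := by
    intro x
    by_cases hx : x ∈ I
    · rw [hrow x hx]; exact hκpos x hx
    · simp [k, hx]
  have hKmk : IsMarkovKernel (stepK lam k) := stepK_markov hk hr hpos
  have hpiP : IsProbabilityMeasure (piM lam k) := piM_prob hk hr hpos
  have hstepK : ∀ x ∈ I, ∀ A, MeasurableSet A →
      ENNReal.ofReal (markovStep κ x A) = stepK lam k x A := by
    intro x hx A hA
    rw [markovStep, ← hset x hx A hA, ← hrow x hx, ENNReal.ofReal_div_of_pos (hpos x),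
      ← dE_eq (lam := lam) hk hr, ← lintegral_indicator_one hA,
      stepK_lintegral hk x (measurable_one.indicator hA),
      ofReal_integral_eq_lintegral_ofReal (k_int hk hr x).integrableOn
        (ae_of_all _ fun y => (hr x y).1), ← lintegral_indicator hA]
    congr 2 with y
    by_cases hy : y ∈ A <;> simp [hy]
  have hKI : ∀ x ∈ I, ∀ᵐ y ∂(stepK lam k x), y ∈ I := by
    intro x hx
    change stepK lam k x Iᶜ = 0
    rw [← hstepK x hx _ hI.compl, markovStep]
    simp [← hIdef]
  have hst : ∀ x ∈ I, ∀ᵐ ω ∂(P x), ω 0 = x := by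
    intro x hx
    have hm : MeasurableSet {ω : ℕ → ℝ | ω 0 = x} :=
      measurableSet_eq_fun (measurable_pi_apply 0) measurable_const
    exact (prob_compl_eq_zero_iff hm).2 (hstart x hx)
  have hin : ∀ x ∈ I, ∀ n, ∀ᵐ ω ∂(P x), ω n ∈ I := by
    intro x hx n
    cases n with
    | zero =>
      filter_upwards [hst x hx] with ω h
      rw [h]; exact hx
    | succ n =>
      have := hMarkov x hx n Set.univ MeasurableSet.univ Iᶜ hI.compl
      have h0 : ∀ z, markovStep κ z Iᶜ = 0 := fun z => by simp [markovStep, ← hIdef]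
      simp only [h0, Set.mem_univ, true_and, ENNReal.ofReal_zero, lintegral_zero] at this
      exact this
  have hM : ∀ x ∈ I, ∀ (n : ℕ) (B : Set (Fin (n + 1) → ℝ)),
      MeasurableSet B → ∀ A : Set ℝ, MeasurableSet A →
      P x {ω | (fun i : Fin (n + 1) => ω i.1) ∈ B ∧ ω (n + 1) ∈ A}
        = ∫⁻ ω in {ω : ℕ → ℝ | (fun i : Fin (n + 1) => ω i.1) ∈ B},
          stepK lam k (ω n) A ∂(P x) := by
    intro x hx n B hB A hA
    rw [hMarkov x hx n B hB A hA]
    refine lintegral_congr_ae (ae_restrict_of_ae ?_)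
    filter_upwards [hin x hx n] with ω hω
    exact hstepK _ hω A hA
  have hconn : ∀ A, MeasurableSet A → lam A ≠ 0 → lam Aᶜ ≠ 0 →
      0 < ∫ x in A, ∫ y in Aᶜ, k x y ∂lam ∂lam := by
    intro A hA h0 h1
    have e : lam A = volume (A ∩ I) := by rw [hlam, Measure.restrict_apply hA]
    have hlt : lam A < 1 := by
      refine lt_of_le_of_ne prob_le_one fun h => h1 ?_
      exact (prob_compl_eq_zero_iff hA).2 h
    have := hκconn (A ∩ I) Set.inter_subset_right (hA.inter hI)
      (e ▸ pos_iff_ne_zero.2 h0) (e ▸ hlt)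
    have e2 : I \ (A ∩ I) = Aᶜ ∩ I := by ext; simp; tauto
    rw [e2] at this
    have e3 : ∫ x in A, ∫ y in Aᶜ, k x y ∂lam ∂lam
        = ∫ x in A ∩ I, ∫ y in Aᶜ ∩ I, κ x y := by
      conv_lhs => rw [hlam, Measure.restrict_restrict hA]
      exact setIntegral_congr_fun (hA.inter hI) fun x hx => hset x hx.2 _ hA.compl
    rw [e3]; exact this
  obtain ⟨Pk, hPkM, hPkP, hPkS⟩ := exists_pathKernel hP hst hM hI hKI 0
  have hpiI : ∀ᵐ x ∂(piM lam k), x ∈ I :=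
    (withDensity_absolutelyContinuous _ _ : piM lam k ≪ lam).ae_le (ae_restrict_mem hI)
  have herg : Ergodic (shiftMap ℝ) (Pk ∘ₘ piM lam k) := by
    refine ergodic_shift (K := stepK lam k) ?_ (piM_inv hk hs hr hpos)
      (harm_const hk hs hr hpos hconn)
    filter_upwards [hpiI] with x hx using hPkS x hx
  have hF : Measurable (fun ω : ℕ → ℝ => f (ω 0)) := hf.comp (measurable_pi_apply 0)
  have hb := birkhoff_ergodic herg hF (fun ω => hC (ω 0))
  have hmap : (Pk ∘ₘ piM lam k).map (fun ω : ℕ → ℝ => ω 0) = piM lam k := by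
    ext A hA
    rw [Measure.map_apply (measurable_pi_apply 0) hA,
      Measure.bind_apply (measurable_pi_apply 0 hA) Pk.aemeasurable,
      ← lintegral_indicator_one hA]
    refine lintegral_congr_ae ?_
    filter_upwards [hpiI] with x hx
    have := hPkS x hx A Set.univ hA MeasurableSet.univ
    simpa using this
  have hint : ∫ ω, f (ω 0) ∂(Pk ∘ₘ piM lam k) = ∫ y in I, f y * ((∫ v in I, κ y v) /
              ∫ u in I, ∫ v in I, κ u v) := by
    rw [← integral_map (φ := fun ω : ℕ → ℝ => ω 0) (measurable_pi_apply 0).aemeasurable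
      hf.aestronglyMeasurable, hmap, piM_integral hk hr]
    have e : ∫ u, ∫ v, k u v ∂lam ∂lam = ∫ u in I, ∫ v in I, κ u v :=
      setIntegral_congr_fun hI fun x hx => hrow x hx
    rw [e]
    refine setIntegral_congr_fun hI fun x hx => ?_
    simp only [hrow x hx]
  rw [hint] at hb
  have hb2 := Measure.ae_ae_of_ae_comp hb
  have hb3 := (lam_ac hk hr hpos).ae_le hb2
  have hit : ∀ (i : ℕ) (ω : ℕ → ℝ), ((shiftMap ℝ)^[i] ω) 0 = ω i := by
    have : ∀ (i : ℕ) (ω : ℕ → ℝ) (j : ℕ), ((shiftMap ℝ)^[i] ω) j = ω (j + i) := by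
      intro i
      induction i with
      | zero => simp
      | succ i ih =>
        intro ω j
        rw [Function.iterate_succ_apply, ih, shiftMap, add_assoc]
    intro i ω; simpa using this i ω 0
  filter_upwards [hb3, ae_restrict_mem hI] with x hx hxI
  change ∀ᵐ ω ∂(Pk x), _ at hx
  rw [hPkP x hxI] at hx
  filter_upwards [hx] with ω hω
  simpa only [birkhoffSum, hit] using hω
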